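/- arXiv:2210.14719 — 2 statements merged into one kernel-verified Lean document; each statement's English description precedes it below -/
import Mathlib

section
/- For every folding instruction set f, S_f(6) ∈ {31, 32, 47, 48}, and consequently A_f(6) ∈ {36, 37, 52, 53}. -/
/-- A folding instruction set: a sequence with values in {-1, 1}. -/
def FoldingSeq (f : ℕ → ℤ) : Prop := ∀ s, f s = 1 ∨ f s = -1

/-- The paper-folding sequence `P_f`: if `k = 2^s * r` with `r` odd, then
`P_f[k] = f s` if `r ≡ 1 [MOD 4]` and `P_f[k] = -f s` if `r ≡ 3 [MOD 4]`. -/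
def PF (f : ℕ → ℤ) (k : ℕ) : ℤ :=
  if (k / 2 ^ (padicValNat 2 k)) % 4 = 1 then f (padicValNat 2 k)
  else -f (padicValNat 2 k)

/-- The length-`n` factors of `P_f` starting at indices `i` and `j` are identical. -/
def FactorMatch (f : ℕ → ℤ) (n i j : ℕ) : Prop :=
  ∀ t, t < n → PF f (i + t) = PF f (j + t)

/-- `Sf f n` : the least positive integer `m` such that every length-`n` factor of `P_f`
starts somewhere within the first `m` positions. -/
noncomputable def Sf (f : ℕ → ℤ) (n : ℕ) : ℕ :=
  sInf {m | 1 ≤ m ∧ ∀ i, 1 ≤ i → ∃ j, 1 ≤ j ∧ j ≤ m ∧ FactorMatch f n i j}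

/-- `Af f n` : the least positive integer `m` such that every length-`n` factor of `P_f`
appears entirely within the prefix `P_f[1..m]`. -/
noncomputable def Af (f : ℕ → ℤ) (n : ℕ) : ℕ :=
  sInf {m | 1 ≤ m ∧ ∀ i, 1 ≤ i → ∃ j, 1 ≤ j ∧ j + n - 1 ≤ m ∧ FactorMatch f n i j}

/-- `phi2 n` : the least power of 2 that is `≥ n`, i.e. `2 ^ ⌈log₂ n⌉`. -/
def phi2 (n : ℕ) : ℕ := 2 ^ Nat.clog 2 n

theorem PF_two_mul (f : ℕ → ℤ) {k : ℕ} (hk : k ≠ 0) :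
    PF f (2 * k) = PF (fun s => f (s + 1)) k := by
  have hv : padicValNat 2 (2 * k) = padicValNat 2 k + 1 := by
    rw [padicValNat.mul two_ne_zero hk, padicValNat_self, add_comm]
  have hd : 2 * k / 2 ^ (padicValNat 2 k + 1) = k / 2 ^ padicValNat 2 k := by
    rw [pow_succ', Nat.mul_div_mul_left _ _ two_pos]
  simp only [PF, hv, hd]

theorem PF_odd (f : ℕ → ℤ) {k : ℕ} (hk : k % 2 = 1) :
    PF f k = if k % 4 = 1 then f 0 else -f 0 := by
  have hv : padicValNat 2 k = 0 := padicValNat.eq_zero_of_not_dvd (by omega)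
  simp [PF, hv]

theorem PF_add_two_pow (f : ℕ → ℤ) {n k : ℕ} (hk : ¬ 2 ^ n ∣ k) :
    PF f (k + 2 ^ (n + 1)) = PF f k := by
  induction n generalizing f k with
  | zero => simp at hk
  | succ n ih =>
    have hp : 2 ^ (n + 1 + 1) = 4 * 2 ^ n := by ring
    rcases Nat.even_or_odd' k with ⟨j, rfl | rfl⟩
    · have hj : ¬ 2 ^ n ∣ j := fun h => hk (by rw [pow_succ']; exact Nat.mul_dvd_mul_left 2 h)
      have hj0 : j ≠ 0 := by rintro rfl; exact hj (dvd_zero _)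
      rw [pow_succ' 2 (n + 1), ← mul_add, PF_two_mul f (by omega), PF_two_mul f hj0, ih _ hj]
    · rw [hp, PF_odd f (by omega), PF_odd f (by omega),
        show (2 * j + 1 + 4 * 2 ^ n) % 4 = (2 * j + 1) % 4 by omega]

theorem PF_add_two_pow_mul (f : ℕ → ℤ) {n k : ℕ} (hk : ¬ 2 ^ n ∣ k) (q : ℕ) :
    PF f (k + 2 ^ (n + 1) * q) = PF f k := by
  induction q with
  | zero => simp
  | succ q ih =>
    rw [mul_add, mul_one, ← add_assoc, PF_add_two_pow f, ih]
    rwa [← Nat.dvd_add_iff_left (Dvd.dvd.mul_right (pow_dvd_pow 2 n.le_succ) q)]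

theorem PF_eq_of_mod_eq (f : ℕ → ℤ) {n k l : ℕ} (hk : ¬ 2 ^ n ∣ k)
    (h : k % 2 ^ (n + 1) = l % 2 ^ (n + 1)) : PF f k = PF f l := by
  have hdvd : 2 ^ n ∣ 2 ^ (n + 1) := pow_dvd_pow 2 n.le_succ
  have hm : ¬ 2 ^ n ∣ k % 2 ^ (n + 1) := by rwa [Nat.dvd_mod_iff hdvd]
  calc PF f k = PF f (k % 2 ^ (n + 1) + 2 ^ (n + 1) * (k / 2 ^ (n + 1))) := by
        rw [Nat.mod_add_div]
    _ = PF f (l % 2 ^ (n + 1) + 2 ^ (n + 1) * (l / 2 ^ (n + 1))) := by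
        rw [PF_add_two_pow_mul f hm, h, PF_add_two_pow_mul f (h ▸ hm)]
    _ = PF f l := by rw [Nat.mod_add_div]

theorem PF_eq_or_eq_neg {f : ℕ → ℤ} (hf : FoldingSeq f) (k : ℕ) : PF f k = 1 ∨ PF f k = -1 := by
  unfold PF
  rcases hf (padicValNat 2 k) with h | h <;> split_ifs <;> simp [h]

/-- Every factor of length `6` starts within the first `48` positions. -/
theorem exists_factorMatch_le {f : ℕ → ℤ} (hf : FoldingSeq f) (i : ℕ) :
    ∃ j, 1 ≤ j ∧ j ≤ 48 ∧ FactorMatch f 6 i j := by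
  by_cases h : ∃ t < 6, 16 ∣ i + t
  · obtain ⟨u, hu, hd⟩ := h
    have h16 : PF f 16 = f 4 := by
      rw [show 16 = 2 * (2 * (2 * (2 * 1))) by rfl, PF_two_mul, PF_two_mul, PF_two_mul,
        PF_two_mul, PF_odd] <;> norm_num
    have h48 : PF f 48 = -f 4 := by
      rw [show 48 = 2 * (2 * (2 * (2 * 3))) by rfl, PF_two_mul, PF_two_mul, PF_two_mul,
        PF_two_mul, PF_odd] <;> norm_num
    obtain ⟨c, hc, hPF⟩ : ∃ c, (c = 16 ∨ c = 48) ∧ PF f (i + u) = PF f c := by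
      rcases PF_eq_or_eq_neg hf (i + u) with h | h <;> rcases hf 4 with h4 | h4
      · exact ⟨16, by simp, by omega⟩
      · exact ⟨48, by simp, by omega⟩
      · exact ⟨48, by simp, by omega⟩
      · exact ⟨16, by simp, by omega⟩
    refine ⟨c - u, by omega, by omega, fun t ht => ?_⟩
    by_cases htu : t = u
    · rw [htu, hPF, Nat.sub_add_cancel (by omega)]
    · exact PF_eq_of_mod_eq f (n := 3) (by omega) (by omega)
  · push Not at h
    refine ⟨i % 32, ?_, by omega, fun t ht => ?_⟩
    · have := h 0 (by norm_num)
      omega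
    · have := h t ht
      exact PF_eq_of_mod_eq f (n := 4) (by omega) (by omega)

/-- The term of index `k` of a paper-folding sequence whose instructions start with `l`, where
`true` stands for `-1`; it is meaningful for `0 < k < 2 ^ l.length`. -/
def foldBit : List Bool → ℕ → Bool
  | [], _ => false
  | a :: l, k => bif k % 2 == 0 then foldBit l (k / 2) else (a ^^ (k % 4 == 3))

/-- The sign encoded by a bit. -/
def bitSign (b : Bool) : ℤ := bif b then -1 else 1

theorem bitSign_injective : Function.Injective bitSign := by decide

theorem PF_eq_bitSign_foldBit (f : ℕ → ℤ) (l : List Bool)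
    (hl : ∀ s (hs : s < l.length), f s = bitSign l[s]) {k : ℕ} (hk : k ≠ 0)
    (hkl : k < 2 ^ l.length) : PF f k = bitSign (foldBit l k) := by
  induction l generalizing f k with
  | nil => simp at hkl; omega
  | cons a l ih =>
    rcases Nat.even_or_odd' k with ⟨j, rfl | rfl⟩
    · rw [PF_two_mul f (by omega), ih (fun s => f (s + 1)) _ (by omega)]
      · simp [foldBit]
      · rw [List.length_cons, pow_succ'] at hkl
        omega
      · intro s hs
        exact hl (s + 1) (Nat.succ_lt_succ hs)
    · have h0 : f 0 = bitSign a := hl 0 (Nat.succ_pos _)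
      rw [PF_odd f (by omega), h0]
      have h2 : (2 * j + 1) % 2 = 1 := by omega
      rcases (by omega : (2 * j + 1) % 4 = 1 ∨ (2 * j + 1) % 4 = 3) with h4 | h4 <;>
        cases a <;> simp [foldBit, bitSign, h2, h4]

/-- The length-`6` windows of `foldBit l` at `i` and `j` agree. -/
def bitMatch (l : List Bool) (i j : ℕ) : Bool :=
  (List.range 6).all fun t => foldBit l (i + t) == foldBit l (j + t)

/-- The length-`6` window of `foldBit l` at `s` does not occur earlier, and every window starting
at `s + 1, …, 48` occurs at one of `1, …, s`; so `s` is the least bound on starting positions. -/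
def isLeastBound (l : List Bool) (s : ℕ) : Bool :=
  ((List.range (s - 1)).all fun j => !bitMatch l s (j + 1)) &&
    (List.range (48 - s)).all fun i => (List.range s).any fun j => bitMatch l (s + i + 1) (j + 1)

theorem exists_isLeastBound : ∀ a b c d e g : Bool,
    ([31, 32, 47, 48].any fun s => isLeastBound [a, b, c, d, e, g] s) = true := by
  decide +kernel

theorem factorMatch_iff_bitMatch {f : ℕ → ℤ} {l : List Bool} (hlen : l.length = 6)
    (hl : ∀ s (hs : s < l.length), f s = bitSign l[s]) {i j : ℕ} (hi1 : 1 ≤ i) (hi : i ≤ 48)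
    (hj1 : 1 ≤ j) (hj : j ≤ 48) : FactorMatch f 6 i j ↔ bitMatch l i j = true := by
  simp only [FactorMatch, bitMatch, List.all_eq_true, List.mem_range, beq_iff_eq]
  refine forall₂_congr fun t ht => ?_
  rw [PF_eq_bitSign_foldBit f l hl (by omega) (by rw [hlen]; omega),
    PF_eq_bitSign_foldBit f l hl (by omega) (by rw [hlen]; omega), bitSign_injective.eq_iff]

theorem isLeast_of_isLeastBound {f : ℕ → ℤ} (hf : FoldingSeq f) {l : List Bool}
    (hlen : l.length = 6) (hl : ∀ s (hs : s < l.length), f s = bitSign l[s]) {s : ℕ}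
    (hs1 : 1 ≤ s) (hs : s ≤ 48) (h : isLeastBound l s = true) :
    IsLeast {m | 1 ≤ m ∧ ∀ i, 1 ≤ i → ∃ j, 1 ≤ j ∧ j ≤ m ∧ FactorMatch f 6 i j} s := by
  simp only [isLeastBound, Bool.and_eq_true, List.all_eq_true, List.any_eq_true, List.mem_range,
    Bool.not_eq_true'] at h
  obtain ⟨hlower, hupper⟩ := h
  refine ⟨⟨hs1, fun i _ => ?_⟩, fun m ⟨_, hm⟩ => ?_⟩
  · obtain ⟨i', hi1, hi48, hii'⟩ := exists_factorMatch_le hf i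
    rcases le_or_gt i' s with his | his
    · exact ⟨i', hi1, his, hii'⟩
    obtain ⟨k, rfl⟩ := Nat.exists_eq_add_of_lt his
    obtain ⟨j, hj, hij⟩ := hupper k (by omega)
    rw [← factorMatch_iff_bitMatch hlen hl hi1 hi48 (by omega) (by omega)] at hij
    exact ⟨j + 1, by omega, by omega, fun t ht => (hii' t ht).trans (hij t ht)⟩
  · by_contra! hms
    obtain ⟨j, hj1, hjm, hij⟩ := hm s hs1
    obtain ⟨j, rfl⟩ := Nat.exists_eq_add_of_le' hj1
    rw [factorMatch_iff_bitMatch hlen hl hs1 hs hj1 (by omega), hlower j (by omega)] at hij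
    exact Bool.false_ne_true hij

/-- `Af f n = Sf f n + n - 1`, phrased through the least bound on starting positions. -/
theorem Af_eq_of_isLeast {f : ℕ → ℤ} {n s : ℕ} (hn : 1 ≤ n)
    (h : IsLeast {m | 1 ≤ m ∧ ∀ i, 1 ≤ i → ∃ j, 1 ≤ j ∧ j ≤ m ∧ FactorMatch f n i j} s) :
    Af f n = s + n - 1 := by
  obtain ⟨⟨hs1, hs⟩, hleast⟩ := h
  refine IsLeast.csInf_eq ⟨⟨?_, fun i hi => ?_⟩, fun m ⟨_, hm⟩ => ?_⟩
  · omega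
  · obtain ⟨j, hj1, hjs, hij⟩ := hs i hi
    exact ⟨j, hj1, by omega, hij⟩
  · obtain ⟨j, hj1, hjm, _⟩ := hm 1 le_rfl
    have : s ≤ m + 1 - n := hleast ⟨by omega, fun i hi => by
      obtain ⟨j, hj1, hjm, hij⟩ := hm i hi
      exact ⟨j, hj1, by omega, hij⟩⟩
    omega

theorem stmt13 (f : ℕ → ℤ) (hf : FoldingSeq f) :
    Sf f 6 ∈ ({31, 32, 47, 48} : Set ℕ) ∧ Af f 6 ∈ ({36, 37, 52, 53} : Set ℕ) := by
  have hsign : ∀ s, f s = bitSign (f s == -1) := fun s => by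
    rcases hf s with h | h <;> simp [h, bitSign]
  let l : List Bool := (List.range 6).map fun s => f s == -1
  have hl : ∀ s (hs : s < l.length), f s = bitSign l[s] := fun s hs => by
    simpa [l] using hsign s
  obtain ⟨s, hs, h⟩ := List.any_eq_true.1 (exists_isLeastBound (f 0 == -1) (f 1 == -1)
    (f 2 == -1) (f 3 == -1) (f 4 == -1) (f 5 == -1))
  simp only [List.mem_cons, List.not_mem_nil, or_false] at hs
  have hleast := isLeast_of_isLeastBound hf (l := l) (by simp [l]) hl (by omega) (by omega) h
  rw [Af_eq_of_isLeast (by norm_num) hleast, show Sf f 6 = s from hleast.csInf_eq]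
  rcases hs with rfl | rfl | rfl | rfl <;> simp
end

section
/- Let n ≥ 7 and suppose n is a power of 2, say n = 2^k (so k ≥ 3). Then the length-n factor P_f[6n : 7n−1] occurs starting at index 4n (i.e., P_f[4n+t] = P_f[6n+t] for all 0 ≤ t < n) if and only if f_{k+1} ≠ f_{k+2}. -/
theorem PF_two_pow_mul (f : ℕ → ℤ) (s r : ℕ) (hr : r % 2 = 1) :
    PF f (2 ^ s * r) = if r % 4 = 1 then f s else -f s := by
  have hv : padicValNat 2 (2 ^ s * r) = s := by
    rw [padicValNat.mul (by positivity) (by omega), padicValNat.prime_pow,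
      padicValNat.eq_zero_of_not_dvd (by omega), add_zero]
  rw [PF, hv, Nat.mul_div_cancel_left _ (by positivity)]

theorem PF_add_mul_two_pow (f : ℕ → ℤ) (k c t : ℕ) (ht : 0 < t) (htk : t < 2 ^ k) :
    PF f (2 * c * 2 ^ k + t) = PF f t := by
  obtain ⟨s, r, hr, rfl⟩ := Nat.exists_eq_two_pow_mul_odd ht.ne'
  have hr2 : r % 2 = 1 := Nat.odd_iff.mp hr
  have hsk : s < k := by
    refine (Nat.pow_lt_pow_iff_right (a := 2) (by norm_num)).mp (lt_of_le_of_lt ?_ htk)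
    exact Nat.le_mul_of_pos_right _ (by omega)
  obtain ⟨d, rfl⟩ := Nat.exists_eq_add_of_lt hsk
  have h : 2 * c * 2 ^ (s + d + 1) + 2 ^ s * r = 2 ^ s * (r + 4 * (c * 2 ^ d)) := by ring
  rw [h, PF_two_pow_mul f s _ (by omega), PF_two_pow_mul f s r hr2, Nat.add_mul_mod_self_left]

theorem stmt14 (f : ℕ → ℤ) (hf : FoldingSeq f) (n k : ℕ) (hn : 7 ≤ n)
    (hpow : n = 2 ^ k) :
    FactorMatch f n (4 * n) (6 * n) ↔ f (k + 1) ≠ f (k + 2) := by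
  subst hpow
  have h4 : PF f (4 * 2 ^ k) = f (k + 2) := by
    rw [show 4 * 2 ^ k = 2 ^ (k + 2) * 1 by ring, PF_two_pow_mul f _ _ (by norm_num)]
    simp
  have h6 : PF f (6 * 2 ^ k) = -f (k + 1) := by
    rw [show 6 * 2 ^ k = 2 ^ (k + 1) * 3 by ring, PF_two_pow_mul f _ _ (by norm_num)]
    simp
  have hiff : f (k + 2) = -f (k + 1) ↔ f (k + 1) ≠ f (k + 2) := by
    rcases hf (k + 1) with h | h <;> rcases hf (k + 2) with h' | h' <;> simp [h, h']
  rw [← hiff]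
  constructor
  · intro h
    simpa [h4, h6] using h 0 (by positivity)
  · intro h t ht
    rcases Nat.eq_zero_or_pos t with rfl | hpos
    · simpa [h4, h6] using h
    · rw [PF_add_mul_two_pow f k 2 t hpos ht, PF_add_mul_two_pow f k 3 t hpos ht]
end
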